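/- Let λ > 0 be a real number. For every n ∈ ℕ, the modified degenerate Hermite-based tangent polynomials (of order 1) satisfy _HT_n(x+2, y:λ) + _HT_n(x, y:λ) = 2 · H_n(x, y:λ), for all real x, y. -/

import Mathlib

open PowerSeries Finset

/-- The formal power series `e^{a t}`. -/
noncomputable def expX (a : ℝ) : PowerSeries ℝ :=
  PowerSeries.mk fun n => a ^ n / n.factorial

/-- The formal power series `e^{a t^2}`. -/
noncomputable def expX2 (a : ℝ) : PowerSeries ℝ :=
  PowerSeries.mk fun n => if 2 ∣ n then a ^ (n / 2) / (n / 2).factorial else 0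

/-- The formal power series `e^{x t + y t^2}`. -/
noncomputable def expH (x y : ℝ) : PowerSeries ℝ := expX x * expX2 y

theorem expX_eq_rescale_exp (a : ℝ) : expX a = rescale a (exp ℝ) := by
  ext n
  simp [expX, coeff_rescale, coeff_exp, div_eq_mul_inv]

theorem expX_add (a b : ℝ) : expX (a + b) = expX a * expX b := by
  simp only [expX_eq_rescale_exp, exp_mul_exp_eq_exp_add]

theorem expX_add_one_ne_zero (a : ℝ) : expX a + 1 ≠ 0 := by
  intro h
  have h0 := congrArg (coeff 0) h
  norm_num [expX] at h0

theorem expH_add_left (x x' y : ℝ) : expH (x + x') y = expH x y * expX x' := by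
  simp only [expH, expX_add]
  ring

/-- for λ > 0, `_HT_n(x+2,y:λ) + _HT_n(x,y:λ) = 2 H_n(x,y:λ)`. -/
theorem modified_degenerate_hermite_tangent_order_one
    (l : ℝ) (hl : 0 < l)
    (T : ℕ → ℝ → ℝ → ℝ) (Hd : ℕ → ℝ → ℝ → ℝ)
    (hT : ∀ x y : ℝ,
      (PowerSeries.mk fun n => T n x y / n.factorial) * (expX (2 * Real.log (1 + l) / l) + 1)
        = 2 * expH (x * Real.log (1 + l) / l) (y * Real.log (1 + l) / l))
    (hH : ∀ x y : ℝ,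
      (PowerSeries.mk fun n => Hd n x y / n.factorial)
        = expH (x * Real.log (1 + l) / l) (y * Real.log (1 + l) / l))
    (n : ℕ) (x y : ℝ) :
    T n (x + 2) y + T n x y = 2 * Hd n x y := by
  have key : (PowerSeries.mk fun n => T n (x + 2) y / n.factorial) +
      (PowerSeries.mk fun n => T n x y / n.factorial) =
      2 * PowerSeries.mk fun n => Hd n x y / n.factorial := by
    apply mul_right_cancel₀ (expX_add_one_ne_zero (2 * Real.log (1 + l) / l))
    have hx : (x + 2) * Real.log (1 + l) / l =
        x * Real.log (1 + l) / l + 2 * Real.log (1 + l) / l := by ring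
    rw [add_mul, hT, hT, hH, hx, expH_add_left]
    ring
  have hn := congrArg (coeff n) key
  rw [two_mul] at hn
  simp only [map_add, coeff_mk] at hn
  have hf : (n.factorial : ℝ) ≠ 0 := mod_cast n.factorial_ne_zero
  field_simp at hn
  linarith
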